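/- (Lemma 1) Let A be a random M×N matrix over F_q whose M·N entries are i.i.d. with distribution μ, where M ≥ N ≥ 1. Then the probability that rank(A) < N is at most η_max(N,M) = 1 − Π_{i=1}^{N} (1 − β_max^{M−i+1}), where β_max = max(ε_SR, (1−ε_SR)/(q−1)). -/

import Mathlib

open Finset
open scoped Classical

noncomputable section

/-- The entry distribution μ on the finite field `F`: the value `0` has
probability `ε_SR` and each nonzero value has probability `(1-ε_SR)/(q-1)`,
where `q = |F|`. -/
def muDist (F : Type*) [Field F] [Fintype F] [DecidableEq F] (εSR : ℝ) (t : F) : ℝ :=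
  if t = 0 then εSR else (1 - εSR) / ((Fintype.card F : ℝ) - 1)

/-- The probability that a random `M × N` matrix over `F` with i.i.d.
`μ`-distributed entries equals the fixed matrix `A`. -/
def matProb (F : Type*) [Field F] [Fintype F] [DecidableEq F] (εSR : ℝ) {M N : ℕ}
    (A : Matrix (Fin M) (Fin N) F) : ℝ :=
  ∏ i, ∏ j, muDist F εSR (A i j)

section Helpers

variable {F : Type*} [Field F] [Fintype F] [DecidableEq F] {εSR : ℝ}

/-- The larger of the two values taken by `muDist`. -/
def muMax (F : Type*) [Fintype F] (εSR : ℝ) : ℝ :=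
  max εSR ((1 - εSR) / ((Fintype.card F : ℝ) - 1))

lemma card_sub_one_pos (F : Type*) [Field F] [Fintype F] : 0 < (Fintype.card F : ℝ) - 1 := by
  have : (1 : ℝ) < Fintype.card F := by exact_mod_cast Fintype.one_lt_card
  linarith

lemma muDist_nonneg (h : εSR ∈ Set.Icc (0 : ℝ) 1) (t : F) : 0 ≤ muDist F εSR t := by
  unfold muDist
  split_ifs
  · exact h.1
  · exact div_nonneg (by linarith [h.2]) (card_sub_one_pos F).le

lemma muDist_le_muMax (t : F) : muDist F εSR t ≤ muMax F εSR := by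
  unfold muDist muMax
  split_ifs
  · exact le_max_left _ _
  · exact le_max_right _ _

lemma muMax_nonneg {F : Type*} [Fintype F] {εSR : ℝ} (h : εSR ∈ Set.Icc (0 : ℝ) 1) : 0 ≤ muMax F εSR :=
  h.1.trans (le_max_left _ _)

lemma muMax_le_one {F : Type*} [Field F] [Fintype F] {εSR : ℝ} (h : εSR ∈ Set.Icc (0 : ℝ) 1) :
    muMax F εSR ≤ 1 := by
  refine max_le h.2 ((div_le_one (card_sub_one_pos F)).2 ?_)
  have : (2 : ℝ) ≤ Fintype.card F := by exact_mod_cast Fintype.one_lt_card (α := F)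
  linarith [h.1]

lemma sum_muDist (F : Type*) [Field F] [Fintype F] [DecidableEq F] (εSR : ℝ) :
    ∑ t, muDist F εSR t = 1 := by
  have hne := (card_sub_one_pos F).ne'
  have key (t : F) : muDist F εSR t = (1 - εSR) / ((Fintype.card F : ℝ) - 1) +
      if t = 0 then εSR - (1 - εSR) / ((Fintype.card F : ℝ) - 1) else 0 := by
    unfold muDist
    split_ifs <;> ring
  simp only [key, sum_add_distrib, sum_ite_eq', mem_univ, if_true, sum_const, card_univ,
    nsmul_eq_mul]
  field_simp
  ring

/-- The probability of a vector with i.i.d. `muDist`-distributed coordinates. -/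
def vecProb (F : Type*) [Field F] [Fintype F] [DecidableEq F] (εSR : ℝ) {ι : Type*} [Fintype ι]
    (x : ι → F) : ℝ :=
  ∏ i, muDist F εSR (x i)

lemma vecProb_nonneg {ι : Type*} [Fintype ι] (h : εSR ∈ Set.Icc (0 : ℝ) 1) (x : ι → F) :
    0 ≤ vecProb F εSR x :=
  prod_nonneg fun _ _ => muDist_nonneg h _

lemma sum_vecProb (F : Type*) [Field F] [Fintype F] [DecidableEq F] (εSR : ℝ)
    (ι : Type*) [Fintype ι] [DecidableEq ι] : ∑ x : ι → F, vecProb F εSR x = 1 := by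
  unfold vecProb
  rw [← Fintype.prod_sum (fun (_ : ι) t => muDist F εSR t)]
  simp [sum_muDist]

/-- Some set of at most `finrank V` coordinates determines every vector of the subspace `V`. -/
lemma exists_coordinates_injOn {K ι : Type*} [Field K] [Fintype ι] (V : Submodule K (ι → K)) :
    ∃ s : Finset ι, #s ≤ Module.finrank K V ∧
      Set.InjOn (fun (x : ι → K) (i : s) => x i) (V : Set (ι → K)) := by
  let φ : ι → Module.Dual K V := fun i => (LinearMap.proj i).domRestrict V
  obtain ⟨κ, a, ha, hspan, hli⟩ := exists_linearIndependent' K φ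
  have : Fintype κ := Fintype.ofInjective a ha
  refine ⟨univ.image a, ?_, ?_⟩
  · rw [card_image_of_injective _ ha, card_univ, ← Subspace.dual_finrank_eq]
    exact hli.fintype_card_le_finrank
  · intro x hx y hy hxy
    let z : V := ⟨x, hx⟩ - ⟨y, hy⟩
    have hz : Submodule.span K (Set.range φ) ≤ LinearMap.ker (Module.Dual.eval K V z) := by
      rw [← hspan, Submodule.span_le]
      rintro _ ⟨k, rfl⟩
      have := congrFun hxy ⟨a k, mem_image_of_mem a (mem_univ k)⟩
      simpa [φ, z, sub_eq_zero] using this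
    funext i
    have := hz (Submodule.subset_span ⟨i, rfl⟩)
    simpa [φ, z, sub_eq_zero] using this

/-- A random vector lies in `V` with probability at most `muMax ^ codim V`. -/
lemma sum_vecProb_mem_le {ι : Type*} [Fintype ι] [DecidableEq ι] (h : εSR ∈ Set.Icc (0 : ℝ) 1)
    (V : Submodule F (ι → F)) :
    ∑ x : ι → F with x ∈ V, vecProb F εSR x ≤
      muMax F εSR ^ (Fintype.card ι - Module.finrank F V) := by
  obtain ⟨s, hs, hinj⟩ := exists_coordinates_injOn V
  have hsplit (x : ι → F) : vecProb F εSR x ≤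
      muMax F εSR ^ (Fintype.card ι - Module.finrank F V) *
        vecProb F εSR (fun i : s => x i) := by
    have h1 : vecProb F εSR x =
        (∏ i ∈ sᶜ, muDist F εSR (x i)) * vecProb F εSR (fun i : s => x i) := by
      unfold vecProb
      rw [prod_coe_sort s (fun i => muDist F εSR (x i)), prod_compl_mul_prod]
    rw [h1]
    refine mul_le_mul_of_nonneg_right ?_ (vecProb_nonneg h _)
    calc ∏ i ∈ sᶜ, muDist F εSR (x i) ≤ ∏ _i ∈ sᶜ, muMax F εSR :=
          prod_le_prod (fun _ _ => muDist_nonneg h _) fun _ _ => muDist_le_muMax _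
      _ = muMax F εSR ^ (Fintype.card ι - #s) := by rw [prod_const, card_compl]
      _ ≤ _ := pow_le_pow_of_le_one (muMax_nonneg h) (muMax_le_one h) (by omega)
  calc ∑ x : ι → F with x ∈ V, vecProb F εSR x
      ≤ ∑ x : ι → F with x ∈ V, muMax F εSR ^ (Fintype.card ι - Module.finrank F V) *
          vecProb F εSR (fun i : s => x i) := sum_le_sum fun x _ => hsplit x
    _ = muMax F εSR ^ (Fintype.card ι - Module.finrank F V) *
          ∑ y ∈ (univ.filter (· ∈ V)).image (fun (x : ι → F) (i : s) => x i),
            vecProb F εSR y := by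
        rw [← mul_sum, sum_image]
        intro x hx y hy hxy
        exact hinj (by simpa using hx) (by simpa using hy) hxy
    _ ≤ muMax F εSR ^ (Fintype.card ι - Module.finrank F V) * 1 := by
        refine mul_le_mul_of_nonneg_left ?_ (pow_nonneg (muMax_nonneg h) _)
        rw [← sum_vecProb F εSR s]
        exact sum_le_sum_of_subset_of_nonneg (subset_univ _) fun _ _ _ => vecProb_nonneg h _
    _ = _ := mul_one _

/-- Lower bound for the probability that `n` independent random vectors are linearly
independent. -/
lemma prod_le_sum_linearIndependent {ι : Type*} [Fintype ι] [DecidableEq ι] (h : εSR ∈ Set.Icc (0 : ℝ) 1)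
    (n : ℕ) :
    ∏ i ∈ range n, (1 - muMax F εSR ^ (Fintype.card ι - i)) ≤
      ∑ v : Fin n → ι → F, if LinearIndependent F v then ∏ j, vecProb F εSR (v j) else 0 := by
  induction n with
  | zero => simp
  | succ n ih =>
    rw [prod_range_succ, ← (Fin.consEquiv fun _ => ι → F).sum_comp, Fintype.sum_prod_type_right]
    have hc : 0 ≤ 1 - muMax F εSR ^ (Fintype.card ι - n) :=
      sub_nonneg.2 (pow_le_one₀ (muMax_nonneg h) (muMax_le_one h))
    refine (mul_le_mul_of_nonneg_right ih hc).trans ?_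
    rw [sum_mul]
    refine sum_le_sum fun v _ => ?_
    have hiff (x : ι → F) : LinearIndependent F ((Fin.consEquiv fun _ => ι → F) (x, v)) ↔
        LinearIndependent F v ∧ x ∉ Submodule.span F (Set.range v) := linearIndependent_finCons
    simp only [hiff, Fin.consEquiv_apply, Fin.prod_univ_succ, Fin.cons_zero, Fin.cons_succ]
    by_cases hv : LinearIndependent F v
    · simp only [hv, true_and, if_true]
      rw [← sum_filter, ← sum_mul, mul_comm]
      refine mul_le_mul_of_nonneg_right ?_ (prod_nonneg fun _ _ => vecProb_nonneg h _)
      have hV := sum_vecProb_mem_le h (Submodule.span F (Set.range v))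
      rw [finrank_span_eq_card hv, Fintype.card_fin] at hV
      have hsum := sum_filter_add_sum_filter_not univ
        (· ∈ Submodule.span F (Set.range v)) (vecProb F εSR)
      rw [sum_vecProb] at hsum
      linarith
    · simp [hv]

lemma sum_prod_vecProb (F : Type*) [Field F] [Fintype F] [DecidableEq F] (εSR : ℝ)
    (ι : Type*) [Fintype ι] [DecidableEq ι] (n : ℕ) :
    ∑ v : Fin n → ι → F, ∏ j, vecProb F εSR (v j) = 1 := by
  rw [← Fintype.prod_sum (fun (_ : Fin n) x => vecProb F εSR x)]
  simp [sum_vecProb]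

lemma matProb_transpose {M N : ℕ} (v : Fin N → Fin M → F) :
    matProb F εSR (Matrix.of v).transpose = ∏ j, vecProb F εSR (v j) :=
  prod_comm

lemma rank_transpose_of_linearIndependent {K : Type*} [Field K] {M N : ℕ} {v : Fin N → Fin M → K}
    (hv : LinearIndependent K v) : (Matrix.of v).transpose.rank = N := by
  rw [Matrix.rank_transpose, Matrix.rank_eq_finrank_span_row]
  exact (finrank_span_eq_card hv).trans (Fintype.card_fin N)

end Helpers

/-- Lemma 1: for a random `M × N` matrix `A` over `F_q` with i.i.d.
`μ`-distributed entries, where `M ≥ N ≥ 1`, the probability that `rank(A) < N`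
is at most `η_max(N,M) = 1 − Π_{i=1}^{N} (1 − β_max^{M−i+1})`, where
`β_max = max(ε_SR, (1−ε_SR)/(q−1))`. -/
theorem stmt_11 (F : Type*) [Field F] [Fintype F] [DecidableEq F]
    (hq : 2 ≤ Fintype.card F)
    (εSR : ℝ) (hεSR : εSR ∈ Set.Icc (0 : ℝ) 1)
    (M N : ℕ) (hN : 1 ≤ N) (hMN : N ≤ M) :
    (∑ A : Matrix (Fin M) (Fin N) F,
        if A.rank < N then matProb F εSR A else 0) ≤
      1 - ∏ i ∈ Icc 1 N,
        (1 - (max εSR ((1 - εSR) / ((Fintype.card F : ℝ) - 1))) ^ (M - i + 1)) := by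
  have hbound := prod_le_sum_linearIndependent (F := F) (ι := Fin M) hεSR N
  have htotal := sum_prod_vecProb F εSR (Fin M) N
  have hsum : (∑ A : Matrix (Fin M) (Fin N) F, if A.rank < N then matProb F εSR A else 0) ≤
      ∑ v : Fin N → Fin M → F,
        (∏ j, vecProb F εSR (v j) -
          if LinearIndependent F v then ∏ j, vecProb F εSR (v j) else 0) := by
    rw [← (Matrix.of.trans (Matrix.transposeAddEquiv (Fin N) (Fin M) F).toEquiv).sum_comp]
    refine sum_le_sum fun v _ => ?_
    change (if (Matrix.of v).transpose.rank < N then matProb F εSR (Matrix.of v).transpose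
      else 0) ≤ _
    rw [matProb_transpose]
    have h0 : 0 ≤ ∏ j, vecProb F εSR (v j) := prod_nonneg fun _ _ => vecProb_nonneg hεSR _
    by_cases hv : LinearIndependent F v
    · simp [hv, rank_transpose_of_linearIndependent hv]
    · rw [if_neg hv, sub_zero]
      split_ifs
      exacts [le_rfl, h0]
  rw [sum_sub_distrib, htotal] at hsum
  refine hsum.trans (sub_le_sub_left (le_of_eq_of_le ?_ hbound) 1)
  rw [← Ico_add_one_right_eq_Icc, prod_Ico_eq_prod_range]
  refine prod_congr (by simp) fun i hi => ?_
  have hi' : i < N := by simpa using hi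
  rw [Fintype.card_fin, muMax, show M - (1 + i) + 1 = M - i by omega]
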